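/- arXiv:2304.14263 — 2 statements merged into one kernel-verified Lean document; each statement's English description precedes it below -/
import Mathlib

section
/- Fix an integer m ≥ 1. Let f, g : ℝ → ℂ be smooth functions satisfying the twisted periodicity f(x + 2π) = (-1)^m f(x) and g(x + 2π) = (-1)^m g(x) for all x ∈ ℝ, and assume there is δ > 0 such that f and g vanish on the interval (π - δ, π + δ). For k ∈ ℕ set f̂_{-k} := (2π)^{-1} ∫_{-π}^{π} f(x) e^{i(k + m/2)x} dx, and similarly ĝ_{-k}. Define the smooth compactly supported function f^ℝ : ℝ → ℂ by f^ℝ(x) := (1 + x²/4)^{m/2 - 1} f(2·arctan(x/2)) (a real power of the positive real 1 + x²/4), similarly g^ℝ, and let f̂^ℝ(p) := (2π)^{-1/2} ∫_ℝ f^ℝ(x) e^{-ipx} dx, similarly ĝ^ℝ. Then the series below converges absolutely and Σ_{k=0}^{∞} C(m+k-1, k) · conj(f̂_{-k}) · ĝ_{-k} = (2π·(m-1)!)^{-1} ∫_0^{∞} conj(f̂^ℝ(-p)) · ĝ^ℝ(-p) · p^{m-1} dp, where C(·,·) denotes the binomial coefficient. -/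
open MeasureTheory Real

theorem integrableOn_pow_mul_exp_neg (n : ℕ) {a : ℝ} (ha : 0 < a) :
    IntegrableOn (fun p : ℝ => p ^ n * Real.exp (-(a * p))) (Set.Ioi 0) := by
  have h := integrableOn_rpow_mul_exp_neg_mul_rpow (p := 1) (s := n) (b := a)
    (by have : (0 : ℝ) ≤ n := n.cast_nonneg
        linarith) one_pos ha
  simpa using h

theorem norm_pow_mul_cexp_neg (n : ℕ) (z : ℂ) {p : ℝ} (hp : 0 < p) :
    ‖(p : ℂ) ^ n * Complex.exp (-(z * p))‖ = p ^ n * Real.exp (-(z.re * p)) := by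
  simp [Complex.norm_exp, abs_of_pos hp]

theorem integrableOn_pow_mul_cexp_neg (n : ℕ) {z : ℂ} (hz : 0 < z.re) :
    IntegrableOn (fun p : ℝ => (p : ℂ) ^ n * Complex.exp (-(z * p))) (Set.Ioi 0) := by
  refine (integrableOn_pow_mul_exp_neg n hz).mono' (by fun_prop) ?_
  filter_upwards [ae_restrict_mem measurableSet_Ioi] with p hp
  exact (norm_pow_mul_cexp_neg n z hp).le

theorem tendsto_pow_mul_cexp_neg (n : ℕ) {z : ℂ} (hz : 0 < z.re) :
    Filter.Tendsto (fun p : ℝ => (p : ℂ) ^ n * Complex.exp (-(z * p))) Filter.atTop (nhds 0) := by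
  rw [tendsto_zero_iff_norm_tendsto_zero]
  have h := tendsto_rpow_mul_exp_neg_mul_atTop_nhds_zero n z.re hz
  refine h.congr' ?_
  filter_upwards [Filter.eventually_gt_atTop 0] with p hp
  rw [norm_pow_mul_cexp_neg n z hp]
  simp

/-- The Laplace transform of a monomial at a complex point of the right half-plane. -/
theorem integral_pow_mul_cexp_neg (n : ℕ) {z : ℂ} (hz : 0 < z.re) :
    ∫ p in Set.Ioi (0 : ℝ), (p : ℂ) ^ n * Complex.exp (-(z * p)) = n.factorial * (z ^ (n + 1))⁻¹ := by
  have hz0 : z ≠ 0 := by rintro rfl; simp at hz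
  have hexp (p : ℝ) : HasDerivAt (fun p : ℝ => Complex.exp (-(z * p)))
      (Complex.exp (-(z * p)) * (-z)) p := by
    have h1 : HasDerivAt (fun p : ℝ => (-(z * p) : ℂ)) (-z) p := by
      simpa using ((Complex.ofRealCLM.hasDerivAt (x := p)).const_mul z).fun_neg
    exact h1.cexp
  induction n with
  | zero =>
    have h := integral_Ioi_of_hasDerivAt_of_tendsto (a := 0) (m := 0)
      (f := fun p : ℝ => -z⁻¹ * Complex.exp (-(z * p)))
      (f' := fun p : ℝ => (p : ℂ) ^ 0 * Complex.exp (-(z * p))) (by fun_prop)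
      (fun p _ => by
        convert! (hexp p).const_mul (-z⁻¹) using 1
        field_simp) (integrableOn_pow_mul_cexp_neg 0 hz)
      (by simpa using (tendsto_pow_mul_cexp_neg 0 hz).const_mul (-z⁻¹))
    rw [h]
    simp
  | succ n ih =>
    have hInt := (((integrableOn_pow_mul_cexp_neg n hz).const_mul ((n : ℂ) + 1)).sub
      ((integrableOn_pow_mul_cexp_neg (n + 1) hz).const_mul z))
    have h := integral_Ioi_of_hasDerivAt_of_tendsto (a := 0) (m := 0)
      (f := fun p : ℝ => (p : ℂ) ^ (n + 1) * Complex.exp (-(z * p)))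
      (f' := fun p : ℝ => ((n : ℂ) + 1) * ((p : ℂ) ^ n * Complex.exp (-(z * p)))
        - z * ((p : ℂ) ^ (n + 1) * Complex.exp (-(z * p)))) (by fun_prop)
      (fun p _ => by
        convert! ((Complex.ofRealCLM.hasDerivAt (x := p)).fun_pow (n + 1)).mul (hexp p) using 1
        simp
        ring) hInt (tendsto_pow_mul_cexp_neg (n + 1) hz)
    rw [integral_sub ((integrableOn_pow_mul_cexp_neg n hz).const_mul _)
      ((integrableOn_pow_mul_cexp_neg (n + 1) hz).const_mul z), integral_const_mul,
      integral_const_mul, ih] at h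
    simp only [Complex.ofReal_zero, ne_eq, Nat.add_eq_zero_iff, one_ne_zero, and_false,
      not_false_eq_true, zero_pow, zero_mul, sub_zero] at h
    rw [Nat.factorial_succ]
    push_cast
    have h2 : z * ∫ p in Set.Ioi (0 : ℝ), (p : ℂ) ^ (n + 1) * Complex.exp (-(z * p))
        = ((n : ℂ) + 1) * (n.factorial * (z ^ (n + 1))⁻¹) := by linear_combination -h
    apply mul_left_cancel₀ hz0
    rw [h2]
    field_simp
    ring

/-- The Cayley transform from the upper half-plane to the unit disc. -/
noncomputable def cayley (w : ℂ) : ℂ := (1 + Complex.I * w / 2) / (1 - Complex.I * w / 2)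

theorem one_sub_ne_zero_of_im_nonneg {w : ℂ} (hw : 0 ≤ w.im) : 1 - Complex.I * w / 2 ≠ 0 := by
  intro h
  have := congrArg Complex.re h
  simp at this
  linarith

theorem one_add_ne_zero_of_real (u : ℝ) : 1 + Complex.I * u / 2 ≠ 0 := by
  intro h
  have := congrArg Complex.re h
  simp at this

theorem one_le_norm_one_sub {w : ℂ} (hw : 0 ≤ w.im) : 1 ≤ ‖1 - Complex.I * w / 2‖ := by
  refine le_trans ?_ (Complex.re_le_norm _)
  simp
  linarith

theorem normSq_one_sub (w : ℂ) :
    ‖1 - Complex.I * w / 2‖ ^ 2 = ‖1 + Complex.I * w / 2‖ ^ 2 + 2 * w.im := by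
  rw [← Complex.normSq_eq_norm_sq, ← Complex.normSq_eq_norm_sq, Complex.normSq_apply,
    Complex.normSq_apply]
  simp
  ring

theorem norm_cayley_lt_one {w : ℂ} (hw : 0 < w.im) : ‖cayley w‖ < 1 := by
  have h1 := one_le_norm_one_sub hw.le
  rw [cayley, norm_div, div_lt_one (by linarith)]
  refine lt_of_pow_lt_pow_left₀ 2 (norm_nonneg _) ?_
  rw [normSq_one_sub]
  linarith

theorem norm_cayley_le_one {w : ℂ} (hw : 0 ≤ w.im) : ‖cayley w‖ ≤ 1 := by
  have h1 := one_le_norm_one_sub hw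
  rw [cayley, norm_div, div_le_one (by linarith)]
  refine le_of_sq_le_sq ?_ (norm_nonneg _)
  rw [normSq_one_sub]
  linarith

theorem norm_cayley_neg_real (u : ℝ) : ‖cayley (-u)‖ ≤ 1 := norm_cayley_le_one (by simp)

@[fun_prop]
theorem continuous_cayley_real : Continuous (fun u : ℝ => cayley u) := by
  unfold cayley
  exact Continuous.div (by fun_prop) (by fun_prop)
    fun u => one_sub_ne_zero_of_im_nonneg (by simp)

theorem continuous_inv_one_sub_pow (n : ℕ) :
    Continuous (fun u : ℝ => ((1 - Complex.I * u / 2) ^ n)⁻¹) :=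
  Continuous.inv₀ (by fun_prop) fun u => pow_ne_zero _ (one_sub_ne_zero_of_im_nonneg (by simp))

theorem hasSum_cayley (n : ℕ) {w : ℂ} (hw : 0 < w.im) (u : ℝ) :
    HasSum (fun k : ℕ => ((n + k).choose k : ℂ) *
      (((1 + Complex.I * u / 2) ^ (n + 1))⁻¹ * cayley (-u) ^ k) *
      (((1 - Complex.I * w / 2) ^ (n + 1))⁻¹ * cayley w ^ k))
      (((-Complex.I * (w - u)) ^ (n + 1))⁻¹) := by
  have hr : ‖cayley w * cayley (-u)‖ < 1 := by
    rw [norm_mul]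
    exact mul_lt_one_of_nonneg_of_lt_one_left (norm_nonneg _) (norm_cayley_lt_one hw)
      (norm_cayley_neg_real u)
  have h := (hasSum_choose_mul_geometric_of_norm_lt_one n hr).mul_left
    (((1 + Complex.I * u / 2) ^ (n + 1))⁻¹ * ((1 - Complex.I * w / 2) ^ (n + 1))⁻¹)
  have hu := one_add_ne_zero_of_real u
  have hw' := one_sub_ne_zero_of_im_nonneg hw.le
  convert! h using 1
  · ext k
    rw [show (n + k).choose k = (k + n).choose n by rw [add_comm, Nat.choose_symm_add], mul_pow]
    ring
  · rw [one_div, ← mul_inv, ← mul_inv, ← mul_pow, ← mul_pow]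
    congr 2
    have h (A B c d : ℂ) (hA : A ≠ 0) (hB : B ≠ 0) :
        A * B * (1 - c / B * (d / A)) = A * B - c * d := by field_simp
    rw [cayley, cayley, mul_neg, neg_div, sub_neg_eq_add, ← sub_eq_add_neg, h _ _ _ _ hu hw']
    ring

theorem norm_cayley_factor_le_one (n k : ℕ) {w : ℂ} (hw : 0 ≤ w.im) :
    ‖((1 - Complex.I * w / 2) ^ (n + 1))⁻¹ * cayley w ^ k‖ ≤ 1 := by
  rw [norm_mul, norm_inv, norm_pow, norm_pow]
  exact mul_le_one₀ (inv_le_one_of_one_le₀ (one_le_pow₀ (one_le_norm_one_sub hw)))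
    (by positivity) (pow_le_one₀ (norm_nonneg _) (norm_cayley_le_one hw))

theorem norm_cayley_neg_factor_le_one (n k : ℕ) (u : ℝ) :
    ‖((1 + Complex.I * u / 2) ^ (n + 1))⁻¹ * cayley (-u) ^ k‖ ≤ 1 := by
  simpa [neg_div] using norm_cayley_factor_le_one n k (w := -u) (by simp)

@[fun_prop]
theorem continuous_cayley_factor (n k : ℕ) :
    Continuous fun u : ℝ => ((1 - Complex.I * u / 2) ^ (n + 1))⁻¹ * cayley u ^ k :=
  (continuous_inv_one_sub_pow (n + 1)).mul (continuous_cayley_real.pow k)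

@[fun_prop]
theorem continuous_cayley_neg_factor (n k : ℕ) :
    Continuous fun u : ℝ => ((1 + Complex.I * u / 2) ^ (n + 1))⁻¹ * cayley (-u) ^ k := by
  simpa [Function.comp_def, neg_div] using (continuous_cayley_factor n k).comp continuous_neg

theorem integral_fourier_mul_cexp (n : ℕ) {G : ℝ → ℂ} (hG : Integrable G) {w : ℂ}
    (hw : 0 < w.im) :
    ∫ p in Set.Ioi (0 : ℝ), (∫ u : ℝ, G u * Complex.exp (-(Complex.I * p * u))) *
        (p : ℂ) ^ n * Complex.exp (Complex.I * p * w) =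
      n.factorial * ∫ u : ℝ, G u * ((-Complex.I * (w - u)) ^ (n + 1))⁻¹ := by
  have hre (u : ℝ) : (-Complex.I * (w - u)).re = w.im := by simp
  have hInt : Integrable (Function.uncurry fun (p u : ℝ) =>
      G u * ((p : ℂ) ^ n * Complex.exp (-((-Complex.I * (w - u)) * p))))
      ((volume.restrict (Set.Ioi 0)).prod volume) := by
    refine ((integrableOn_pow_mul_cexp_neg n (z := w.im) (by simpa using hw)).mul_prod hG).mono
      ?_ ?_
    · refine hG.1.comp_snd.mul (Continuous.aestronglyMeasurable ?_)
      fun_prop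
    · have : ∀ᵐ z : ℝ × ℝ ∂((volume.restrict (Set.Ioi 0)).prod volume), 0 < z.1 :=
        Measure.quasiMeasurePreserving_fst.ae (ae_restrict_mem measurableSet_Ioi)
      filter_upwards [this] with z hz
      rw [Function.uncurry, norm_mul, norm_mul _ (G z.2), norm_pow_mul_cexp_neg n _ hz,
        norm_pow_mul_cexp_neg n _ hz, hre, Complex.ofReal_re, mul_comm]
  calc
    _ = ∫ p in Set.Ioi (0 : ℝ), ∫ u : ℝ,
        G u * ((p : ℂ) ^ n * Complex.exp (-((-Complex.I * (w - u)) * p))) := by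
      congr 1
      ext p
      rw [mul_assoc, ← integral_mul_const]
      congr 1
      ext u
      rw [mul_assoc, mul_left_comm (Complex.exp _), ← Complex.exp_add]
      ring_nf
    _ = ∫ u : ℝ, ∫ p in Set.Ioi (0 : ℝ),
        G u * ((p : ℂ) ^ n * Complex.exp (-((-Complex.I * (w - u)) * p))) :=
      integral_integral_swap hInt
    _ = _ := by
      rw [← integral_const_mul]
      congr 1
      ext u
      rw [integral_const_mul, integral_pow_mul_cexp_neg n (by rw [hre]; exact hw)]
      ring

theorem hasSum_integral_mul_cayley (n : ℕ) {G : ℝ → ℂ} (hG : Integrable G) {w : ℂ}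
    (hw : 0 < w.im) :
    HasSum (fun k : ℕ => ((n + k).choose k : ℂ) *
      (∫ u : ℝ, G u * (((1 + Complex.I * u / 2) ^ (n + 1))⁻¹ * cayley (-u) ^ k)) *
      (((1 - Complex.I * w / 2) ^ (n + 1))⁻¹ * cayley w ^ k))
      (∫ u : ℝ, G u * ((-Complex.I * (w - u)) ^ (n + 1))⁻¹) := by
  have hGk (k : ℕ) : Integrable fun u : ℝ =>
      G u * (((1 + Complex.I * u / 2) ^ (n + 1))⁻¹ * cayley (-u) ^ k) :=
    hG.mul_bdd (c := 1) (continuous_cayley_neg_factor n k).aestronglyMeasurable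
      (Filter.Eventually.of_forall fun u => norm_cayley_neg_factor_le_one n k u)
  have hr : ‖(‖cayley w‖ : ℝ)‖ < 1 := by simpa using norm_cayley_lt_one hw
  have hs : Summable fun k : ℕ => ((k + n).choose n : ℝ) * ‖cayley w‖ ^ k :=
    summable_choose_mul_geometric_of_norm_lt_one n hr
  have h := hasSum_integral_of_summable_integral_norm (μ := volume)
    (F := fun (k : ℕ) (u : ℝ) => (((n + k).choose k : ℂ) *
      (((1 - Complex.I * w / 2) ^ (n + 1))⁻¹ * cayley w ^ k)) *
      (G u * (((1 + Complex.I * u / 2) ^ (n + 1))⁻¹ * cayley (-u) ^ k)))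
    (fun k => (hGk k).const_mul _) (by
      refine Summable.of_nonneg_of_le (fun k => integral_nonneg fun u => norm_nonneg _) ?_
        ((hs.mul_right (‖((1 - Complex.I * w / 2) ^ (n + 1))⁻¹‖)).mul_right (∫ u, ‖G u‖))
      intro k
      rw [← integral_const_mul]
      refine integral_mono ((hGk k).const_mul _).norm (hG.norm.const_mul _) fun u => ?_
      simp only [norm_mul (_ * _ : ℂ) (G u * _), norm_mul (G u)]
      refine mul_le_mul (le_of_eq ?_) (mul_le_of_le_one_right (norm_nonneg _)
        (norm_cayley_neg_factor_le_one n k u)) (by positivity) (by positivity)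
      rw [show (n + k).choose k = (k + n).choose n by rw [add_comm, Nat.choose_symm_add]]
      simp only [norm_mul, norm_pow, Complex.norm_natCast]
      ring)
  convert! h using 1
  · ext k
    rw [integral_const_mul]
    ring
  · congr 1
    ext u
    rw [← (hasSum_cayley n hw u).tsum_eq, ← tsum_mul_left]
    congr 1
    ext k
    ring

/-- Boundary version of the expansion of a half-line Fourier integral in powers of the Cayley
transform. -/
theorem tsum_cayley_eq_integral_fourier (n : ℕ) {G : ℝ → ℂ} (hG : Integrable G)
    (hs : Summable fun k : ℕ => ((n + k).choose k : ℝ) *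
      ‖∫ u : ℝ, G u * (((1 + Complex.I * u / 2) ^ (n + 1))⁻¹ * cayley (-u) ^ k)‖)
    (hp : IntegrableOn (fun p : ℝ => (∫ u : ℝ, G u * Complex.exp (-(Complex.I * p * u))) *
      (p : ℂ) ^ n) (Set.Ioi 0)) (v : ℝ) :
    n.factorial * ∑' k : ℕ, ((n + k).choose k : ℂ) *
      (∫ u : ℝ, G u * (((1 + Complex.I * u / 2) ^ (n + 1))⁻¹ * cayley (-u) ^ k)) *
      (((1 - Complex.I * v / 2) ^ (n + 1))⁻¹ * cayley v ^ k) =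
    ∫ p in Set.Ioi (0 : ℝ), (∫ u : ℝ, G u * Complex.exp (-(Complex.I * p * u))) *
        (p : ℂ) ^ n * Complex.exp (Complex.I * p * v) := by
  have hw : Filter.Tendsto (fun ε : ℝ => (v : ℂ) + Complex.I * ε) (nhdsWithin 0 (Set.Ioi 0))
      (nhds (v : ℂ)) := by
    have : Continuous fun ε : ℝ => (v : ℂ) + Complex.I * ε := by fun_prop
    simpa using (this.tendsto 0).mono_left nhdsWithin_le_nhds
  have him (ε : ℝ) : ((v : ℂ) + Complex.I * ε).im = ε := by simp
  have hpos : ∀ᶠ ε : ℝ in nhdsWithin 0 (Set.Ioi 0), 0 < ε := self_mem_nhdsWithin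
  have h1 := (tendsto_tsum_of_dominated_convergence (𝓕 := nhdsWithin (0 : ℝ) (Set.Ioi 0))
    (f := fun (ε : ℝ) (k : ℕ) => ((n + k).choose k : ℂ) *
      (∫ u : ℝ, G u * (((1 + Complex.I * u / 2) ^ (n + 1))⁻¹ * cayley (-u) ^ k)) *
      (((1 - Complex.I * (v + Complex.I * ε) / 2) ^ (n + 1))⁻¹ *
        cayley (v + Complex.I * ε) ^ k))
    (g := fun k : ℕ => ((n + k).choose k : ℂ) *
      (∫ u : ℝ, G u * (((1 + Complex.I * u / 2) ^ (n + 1))⁻¹ * cayley (-u) ^ k)) *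
      (((1 - Complex.I * v / 2) ^ (n + 1))⁻¹ * cayley v ^ k)) hs
    (fun k => by
      have h0 := one_sub_ne_zero_of_im_nonneg (w := v) (by simp)
      have hc : ContinuousAt (fun w : ℂ => ((1 - Complex.I * w / 2) ^ (n + 1))⁻¹ *
          cayley w ^ k) v := by
        unfold cayley
        have hc₁ : ContinuousAt (fun w : ℂ => 1 - Complex.I * w / 2) v := by fun_prop
        have hc₂ : ContinuousAt (fun w : ℂ => 1 + Complex.I * w / 2) v := by fun_prop
        exact ((hc₁.pow (n + 1)).inv₀ (pow_ne_zero _ h0)).mul ((hc₂.div hc₁ h0).pow k)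
      exact (hc.tendsto.comp hw).const_mul _)
    (by
      filter_upwards [hpos] with ε hε k
      rw [norm_mul, norm_mul, Complex.norm_natCast]
      exact mul_le_of_le_one_right (by positivity)
        (norm_cayley_factor_le_one n k (by rw [him]; exact hε.le)))).const_mul
    (n.factorial : ℂ)
  have h2 := tendsto_integral_filter_of_dominated_convergence
    (l := nhdsWithin (0 : ℝ) (Set.Ioi 0)) (μ := volume.restrict (Set.Ioi 0))
    (F := fun (ε p : ℝ) => (∫ u : ℝ, G u * Complex.exp (-(Complex.I * p * u))) *
        (p : ℂ) ^ n * Complex.exp (Complex.I * p * (v + Complex.I * ε)))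
    (f := fun p : ℝ => (∫ u : ℝ, G u * Complex.exp (-(Complex.I * p * u))) *
        (p : ℂ) ^ n * Complex.exp (Complex.I * p * v)) _
    (Filter.Eventually.of_forall fun ε => hp.1.mul (by fun_prop))
    (by
      filter_upwards [hpos] with ε hε
      filter_upwards [ae_restrict_mem measurableSet_Ioi] with p hp0
      rw [norm_mul]
      refine mul_le_of_le_one_right (norm_nonneg _) ?_
      rw [Complex.norm_exp, Real.exp_le_one_iff]
      simpa using mul_nonneg (le_of_lt hp0) hε.le) hp.norm
    (Filter.Eventually.of_forall fun p => by
      have hc : Continuous fun w : ℂ => Complex.exp (Complex.I * p * w) := by fun_prop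
      exact ((hc.tendsto _).comp hw).const_mul _)
  refine tendsto_nhds_unique (h1.congr' ?_) h2
  filter_upwards [hpos] with ε hε
  have hε' : 0 < ((v : ℂ) + Complex.I * ε).im := by rw [him]; exact hε
  rw [(hasSum_integral_mul_cayley n hG hε').tsum_eq, integral_fourier_mul_cexp n hG hε']

theorem tsum_cayley_coeff_eq_integral (n : ℕ) {G H : ℝ → ℂ} (hG : Integrable G)
    (hH : Integrable H)
    (hs : Summable fun k : ℕ => ((n + k).choose k : ℝ) *
      ‖∫ u : ℝ, G u * (((1 + Complex.I * u / 2) ^ (n + 1))⁻¹ * cayley (-u) ^ k)‖)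
    (hp : IntegrableOn (fun p : ℝ => (∫ u : ℝ, G u * Complex.exp (-(Complex.I * p * u))) *
      (p : ℂ) ^ n) (Set.Ioi 0)) :
    (Summable fun k : ℕ => ‖((n + k).choose k : ℂ) *
      (∫ u : ℝ, G u * (((1 + Complex.I * u / 2) ^ (n + 1))⁻¹ * cayley (-u) ^ k)) *
      ∫ v : ℝ, H v * (((1 - Complex.I * v / 2) ^ (n + 1))⁻¹ * cayley v ^ k)‖) ∧
    n.factorial * ∑' k : ℕ, ((n + k).choose k : ℂ) *
      (∫ u : ℝ, G u * (((1 + Complex.I * u / 2) ^ (n + 1))⁻¹ * cayley (-u) ^ k)) *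
      ∫ v : ℝ, H v * (((1 - Complex.I * v / 2) ^ (n + 1))⁻¹ * cayley v ^ k) =
    ∫ p in Set.Ioi (0 : ℝ), (∫ u : ℝ, G u * Complex.exp (-(Complex.I * p * u))) *
        (p : ℂ) ^ n * ∫ v : ℝ, H v * Complex.exp (Complex.I * p * v) := by
  have hbd := tsum_cayley_eq_integral_fourier n hG hs hp
  obtain ⟨A, hA⟩ : ∃ A : ℕ → ℂ, ∀ k, A k =
    ∫ u : ℝ, G u * (((1 + Complex.I * u / 2) ^ (n + 1))⁻¹ * cayley (-u) ^ k) := ⟨_, fun _ => rfl⟩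
  obtain ⟨P, hP⟩ : ∃ P : ℝ → ℂ, ∀ p, P p =
    (∫ u : ℝ, G u * Complex.exp (-(Complex.I * p * u))) * (p : ℂ) ^ n := ⟨_, fun _ => rfl⟩
  simp only [← hA, ← hP] at hs hp hbd ⊢
  have hHk (k : ℕ) : Integrable fun v : ℝ =>
      H v * (((1 - Complex.I * v / 2) ^ (n + 1))⁻¹ * cayley v ^ k) :=
    hH.mul_bdd (c := 1) (continuous_cayley_factor n k).aestronglyMeasurable
      (Filter.Eventually.of_forall fun u => norm_cayley_factor_le_one n k (by simp))
  have hle (k : ℕ) (v : ℝ) :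
      ‖H v * (((1 - Complex.I * v / 2) ^ (n + 1))⁻¹ * cayley v ^ k)‖ ≤ ‖H v‖ := by
    rw [norm_mul]
    exact mul_le_of_le_one_right (norm_nonneg _) (norm_cayley_factor_le_one n k (by simp))
  constructor
  · refine Summable.of_nonneg_of_le (fun k => norm_nonneg _) (fun k => ?_)
      (hs.mul_right (∫ v, ‖H v‖))
    rw [norm_mul, norm_mul, Complex.norm_natCast]
    gcongr
    exact (norm_integral_le_integral_norm _).trans
      (integral_mono (hHk k).norm hH.norm (hle k))
  · have h := hasSum_integral_of_summable_integral_norm (μ := volume)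
      (F := fun (k : ℕ) (v : ℝ) => (((n + k).choose k : ℂ) * A k) *
        (H v * (((1 - Complex.I * v / 2) ^ (n + 1))⁻¹ * cayley v ^ k)))
      (fun k => (hHk k).const_mul _) (by
        refine Summable.of_nonneg_of_le (fun k => integral_nonneg fun u => norm_nonneg _) ?_
          (hs.mul_right (∫ v, ‖H v‖))
        intro k
        rw [← integral_const_mul]
        refine integral_mono ((hHk k).const_mul _).norm (hH.norm.const_mul _) fun v => ?_
        simp only [norm_mul (_ * A k : ℂ), norm_mul _ (A k), Complex.norm_natCast]
        gcongr
        exact hle k v)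
    have hInt : Integrable (Function.uncurry fun (p v : ℝ) =>
        P p * (H v * Complex.exp (Complex.I * p * v)))
        ((volume.restrict (Set.Ioi 0)).prod volume) := by
      refine (hp.mul_prod hH).mono ?_ (Filter.Eventually.of_forall fun z => ?_)
      · exact hp.1.comp_fst.mul (hH.1.comp_snd.mul (by fun_prop))
      · simp [Function.uncurry, Complex.norm_exp]
    have hsum := h.tsum_eq
    have hswap := integral_integral_swap hInt
    simp_rw [integral_const_mul] at hsum hswap
    rw [hsum, hswap, ← integral_const_mul]
    congr 1
    ext v
    rw [show (∫ p in Set.Ioi (0 : ℝ), P p * (H v * Complex.exp (Complex.I * p * v))) =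
        H v * ∫ p in Set.Ioi (0 : ℝ), P p * Complex.exp (Complex.I * p * v) by
        rw [← integral_const_mul]
        congr 1
        ext p
        ring,
      ← hbd v, mul_left_comm, ← tsum_mul_left (a := H v)]
    congr 1
    refine tsum_congr fun k => ?_
    ring

theorem image_two_mul_arctan_half :
    (fun u : ℝ => 2 * Real.arctan (u / 2)) '' Set.univ = Set.Ioo (-π) π := by
  ext x
  simp only [Set.image_univ, Set.mem_range, Set.mem_Ioo]
  constructor
  · rintro ⟨u, rfl⟩
    have h1 := Real.neg_pi_div_two_lt_arctan (u / 2)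
    have h2 := Real.arctan_lt_pi_div_two (u / 2)
    constructor <;> linarith
  · rintro ⟨h1, h2⟩
    refine ⟨2 * Real.tan (x / 2), ?_⟩
    rw [mul_div_cancel_left₀ _ two_ne_zero, Real.arctan_tan (by linarith) (by linarith)]
    ring

theorem hasDerivAt_two_mul_arctan_half (u : ℝ) :
    HasDerivAt (fun u : ℝ => 2 * Real.arctan (u / 2)) ((1 + u ^ 2 / 4)⁻¹) u := by
  have h := (((hasDerivAt_id u).div_const 2).arctan).const_mul 2
  convert! h using 1
  simp only [id_eq]
  field_simp
  ring

theorem cexp_I_mul_arctan (t : ℝ) :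
    Complex.exp (Complex.I * Real.arctan t) = (1 + Complex.I * t) / (√(1 + t ^ 2) : ℝ) := by
  rw [mul_comm, Complex.exp_mul_I, ← Complex.ofReal_cos, ← Complex.ofReal_sin, Real.cos_arctan,
    Real.sin_arctan]
  push_cast
  ring

/-- The pullback to the line of a weight `m / 2` density on the circle. -/
noncomputable def realPullback (m : ℕ) (f : ℝ → ℂ) (x : ℝ) : ℂ :=
  (((1 + x ^ 2 / 4 : ℝ) ^ ((m : ℝ) / 2 - 1) : ℝ) : ℂ) * f (2 * Real.arctan (x / 2))

theorem realPullback_mul_cayley_factor (m k : ℕ) (f : ℝ → ℂ) (u : ℝ) :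
    realPullback m f u * (((1 - Complex.I * u / 2) ^ m)⁻¹ * cayley u ^ k) =
      |(1 + u ^ 2 / 4)⁻¹| • (f (2 * Real.arctan (u / 2)) *
        Complex.exp (Complex.I * ((k : ℂ) + (m : ℂ) / 2) * (2 * Real.arctan (u / 2) : ℝ))) := by
  have hpos : 0 < 1 + u ^ 2 / 4 := by positivity
  have hs : 0 < √(1 + u ^ 2 / 4) := Real.sqrt_pos.mpr hpos
  have hrpow : (1 + u ^ 2 / 4 : ℝ) ^ ((m : ℝ) / 2 - 1) =
      √(1 + u ^ 2 / 4) ^ m * (1 + u ^ 2 / 4)⁻¹ := by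
    rw [Real.rpow_sub_one hpos.ne', Real.sqrt_eq_rpow, ← Real.rpow_mul_natCast hpos.le,
      div_eq_mul_inv]
    ring_nf
  have hE : Complex.exp (Complex.I * ((k : ℂ) + (m : ℂ) / 2) * (2 * Real.arctan (u / 2) : ℝ)) =
      ((1 + Complex.I * u / 2) / (√(1 + u ^ 2 / 4) : ℝ)) ^ (2 * k + m) := by
    have h := cexp_I_mul_arctan (u / 2)
    rw [show 1 + (u / 2) ^ 2 = 1 + u ^ 2 / 4 by ring,
      show Complex.I * ((u / 2 : ℝ) : ℂ) = Complex.I * u / 2 by push_cast; ring] at h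
    rw [← h, ← Complex.exp_nat_mul]
    congr 1
    push_cast
    ring
  have hsq : (1 + Complex.I * u / 2) * (1 - Complex.I * u / 2) =
      ((√(1 + u ^ 2 / 4) : ℝ) : ℂ) ^ 2 := by
    rw [← Complex.ofReal_pow, Real.sq_sqrt hpos.le]
    push_cast
    linear_combination -(u : ℂ) ^ 2 / 4 * Complex.I_sq
  have hA := one_add_ne_zero_of_real u
  have hB := one_sub_ne_zero_of_im_nonneg (w := u) (by simp)
  rw [realPullback, hrpow, hE, abs_of_pos (inv_pos.mpr hpos), cayley, Complex.real_smul,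
    Complex.ofReal_mul, Complex.ofReal_pow]
  have hs' : ((√(1 + u ^ 2 / 4) : ℝ) : ℂ) ≠ 0 := by exact_mod_cast hs.ne'
  generalize ((√(1 + u ^ 2 / 4) : ℝ) : ℂ) = s at *
  generalize 1 + Complex.I * u / 2 = A at *
  generalize 1 - Complex.I * u / 2 = B at *
  have h1 : s ^ m * (B ^ m)⁻¹ = (A / s) ^ m := by
    rw [← inv_pow, ← mul_pow]
    congr 1
    field_simp
    rw [← hsq, mul_comm]
  have h2 : (A / B) ^ k = (A / s) ^ (2 * k) := by
    rw [pow_mul, div_pow A s, ← hsq]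
    congr 1
    field_simp
  rw [h2, pow_add, ← h1]
  ring

theorem integral_circle_eq_integral_realPullback (m k : ℕ) (f : ℝ → ℂ) :
    ∫ x in (-π)..π, f x * Complex.exp (Complex.I * ((k : ℂ) + (m : ℂ) / 2) * x) =
      ∫ u : ℝ, realPullback m f u * (((1 - Complex.I * u / 2) ^ m)⁻¹ * cayley u ^ k) := by
  rw [intervalIntegral.integral_of_le (by linarith [Real.pi_pos]), integral_Ioc_eq_integral_Ioo,
    ← image_two_mul_arctan_half,
    integral_image_eq_integral_abs_deriv_smul MeasurableSet.univ
      (fun u _ => (hasDerivAt_two_mul_arctan_half u).hasDerivWithinAt)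
      (fun u _ v _ h => by
        have h' := Real.arctan_injective (mul_left_cancel₀ two_ne_zero h)
        linarith)]
  simp_rw [realPullback_mul_cayley_factor, setIntegral_univ]

theorem contDiff_realPullback (m : ℕ) {f : ℝ → ℂ} (hf : ContDiff ℝ (⊤ : ℕ∞) f) :
    ContDiff ℝ (⊤ : ℕ∞) (realPullback m f) := by
  unfold realPullback
  refine ContDiff.mul ?_ (hf.comp (contDiff_const.mul (Real.contDiff_arctan.comp
    (contDiff_id.div_const 2))))
  refine Complex.ofRealCLM.contDiff.comp ?_
  refine ContDiff.rpow_const_of_ne (by fun_prop) fun x => ?_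
  positivity

theorem hasCompactSupport_realPullback (m : ℕ) {f : ℝ → ℂ} {δ : ℝ} (hδ : 0 < δ)
    (h₁ : ∀ x ∈ Set.Ioo (π - δ) (π + δ), f x = 0)
    (h₂ : ∀ x ∈ Set.Ioo (-π - δ) (-π + δ), f x = 0) :
    HasCompactSupport (realPullback m f) := by
  have htop : Filter.Tendsto (fun u : ℝ => 2 * Real.arctan (u / 2)) Filter.atTop (nhds π) := by
    have h := ((Real.tendsto_arctan_atTop.mono_right nhdsWithin_le_nhds).comp
      (Filter.tendsto_id.atTop_div_const (two_pos : (0 : ℝ) < 2))).const_mul 2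
    simpa [Function.comp_def, mul_div_cancel₀] using h
  have hbot : Filter.Tendsto (fun u : ℝ => 2 * Real.arctan (u / 2)) Filter.atBot (nhds (-π)) := by
    have h := (htop.comp Filter.tendsto_neg_atBot_atTop).neg
    simpa [Function.comp_def, neg_div] using h
  rw [hasCompactSupport_iff_eventuallyEq, Filter.coclosedCompact_eq_cocompact,
    ← Metric.cobounded_eq_cocompact,
    IsOrderBornology.cobounded_eq, Filter.EventuallyEq, Filter.eventually_sup]
  constructor
  · filter_upwards [hbot.eventually (Ioo_mem_nhds (by linarith : -π - δ < -π)
      (by linarith : -π < -π + δ))] with u hu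
    simp [realPullback, h₂ _ hu]
  · filter_upwards [htop.eventually (Ioo_mem_nhds (by linarith : π - δ < π)
      (by linarith : π < π + δ))] with u hu
    simp [realPullback, h₁ _ hu]

theorem fourier_div_two_pi (G : ℝ → ℂ) (p : ℝ) :
    FourierTransform.fourier G (p / (2 * π)) = ∫ u : ℝ, G u * Complex.exp (-(Complex.I * p * u)) := by
  rw [Real.fourier_eq']
  congr 1
  ext u
  rw [smul_eq_mul, mul_comm]
  congr 2
  have : (π : ℂ) ≠ 0 := by exact_mod_cast Real.pi_ne_zero
  simp
  field_simp

theorem integrable_fourier_mul_pow {G : ℝ → ℂ} (hG : ContDiff ℝ (⊤ : ℕ∞) G)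
    (hc : HasCompactSupport G) (n : ℕ) :
    Integrable (fun p : ℝ => (∫ u : ℝ, G u * Complex.exp (-(Complex.I * p * u))) * (p : ℂ) ^ n) := by
  have hpi : (2 * π) ≠ 0 := by positivity
  let φ : SchwartzMap ℝ ℂ := FourierTransform.fourier (hc.toSchwartzMap hG)
  have hφ (p : ℝ) : φ (p / (2 * π)) = ∫ u : ℝ, G u * Complex.exp (-(Complex.I * p * u)) := by
    rw [← fourier_div_two_pi, SchwartzMap.fourier_coe]
    rfl
  have h := ((φ.integrable_pow_mul volume n).comp_div hpi).const_mul ((2 * π) ^ n)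
  simp_rw [← hφ]
  refine h.mono' ((φ.continuous.comp (by fun_prop)).mul (by fun_prop)).aestronglyMeasurable
    (Filter.Eventually.of_forall fun p => le_of_eq ?_)
  rw [norm_mul, norm_pow, Complex.norm_real, norm_div, Real.norm_of_nonneg (by positivity : 0 ≤ 2 * π),
    div_pow]
  field_simp

theorem exists_pow_mul_norm_fourier_le {G : ℝ → ℂ} (hG : ContDiff ℝ (⊤ : ℕ∞) G)
    (hc : HasCompactSupport G) (N : ℕ) :
    ∃ C : ℝ, ∀ p : ℝ, |p| ^ N * ‖∫ u : ℝ, G u * Complex.exp (-(Complex.I * p * u))‖ ≤ C := by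
  let φ : SchwartzMap ℝ ℂ := FourierTransform.fourier (hc.toSchwartzMap hG)
  have hφ (p : ℝ) : φ (p / (2 * π)) = ∫ u : ℝ, G u * Complex.exp (-(Complex.I * p * u)) := by
    rw [← fourier_div_two_pi, SchwartzMap.fourier_coe]
    rfl
  obtain ⟨C, -, hC⟩ := φ.decay N 0
  refine ⟨(2 * π) ^ N * C, fun p => ?_⟩
  have h := hC (p / (2 * π))
  rw [norm_iteratedFDeriv_zero, hφ, norm_div, Real.norm_of_nonneg (by positivity : 0 ≤ 2 * π),
    Real.norm_eq_abs, div_pow] at h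
  have hpi : 0 < (2 * π) ^ N := by positivity
  calc _ = (2 * π) ^ N * (|p| ^ N / (2 * π) ^ N *
        ‖∫ u : ℝ, G u * Complex.exp (-(Complex.I * p * u))‖) := by field_simp
    _ ≤ _ := by gcongr

theorem contDiff_indicator_Ioo {f : ℝ → ℂ} (hf : ContDiff ℝ (⊤ : ℕ∞) f) {δ : ℝ} (hδ : 0 < δ)
    (h₁ : ∀ x ∈ Set.Ioo (π - δ) (π + δ), f x = 0)
    (h₂ : ∀ x ∈ Set.Ioo (-π - δ) (-π + δ), f x = 0) :
    ContDiff ℝ (⊤ : ℕ∞) ((Set.Ioo (-π) π).indicator f) := by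
  rw [contDiff_iff_contDiffAt]
  intro x
  by_cases hx : x ∈ Set.Ioo (-π) π
  · refine hf.contDiffAt.congr_of_eventuallyEq ?_
    filter_upwards [Ioo_mem_nhds hx.1 hx.2] with y hy
    exact Set.indicator_of_mem hy f
  · refine (contDiffAt_const (c := 0)).congr_of_eventuallyEq ?_
    filter_upwards [Ioo_mem_nhds (by linarith : x - δ < x) (by linarith : x < x + δ)] with y hy
    by_cases hy' : y ∈ Set.Ioo (-π) π
    · rw [Set.indicator_of_mem hy']
      rw [Set.mem_Ioo, not_and_or, not_lt, not_lt] at hx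
      rcases hx with hx | hx
      · exact h₂ y ⟨by linarith [hy'.1], by linarith [hy.2]⟩
      · exact h₁ y ⟨by linarith [hy.1], by linarith [hy'.2]⟩
    · exact Set.indicator_of_notMem hy' f

theorem summable_choose_mul_fourierCoeff (n : ℕ) {f : ℝ → ℂ} (hf : ContDiff ℝ (⊤ : ℕ∞) f)
    {δ : ℝ} (hδ : 0 < δ) (h₁ : ∀ x ∈ Set.Ioo (π - δ) (π + δ), f x = 0)
    (h₂ : ∀ x ∈ Set.Ioo (-π - δ) (-π + δ), f x = 0) :
    Summable fun k : ℕ => ((n + k).choose k : ℝ) * ‖∫ x in (-π)..π,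
      f x * Complex.exp (Complex.I * ((k : ℂ) + ((n + 1 : ℕ) : ℂ) / 2) * x)‖ := by
  have hc : HasCompactSupport ((Set.Ioo (-π) π).indicator f) :=
    HasCompactSupport.intro isCompact_Icc (K := Set.Icc (-π) π) fun x hx =>
      Set.indicator_of_notMem (fun h => hx (Set.Ioo_subset_Icc_self h)) f
  obtain ⟨C, hC⟩ := exists_pow_mul_norm_fourier_le (contDiff_indicator_Ioo hf hδ h₁ h₂) hc (n + 2)
  have hs : Summable fun k : ℕ => 2 ^ (n + 2) * C * (1 / ((k + 1 : ℕ) : ℝ) ^ 2) :=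
    ((summable_nat_add_iff 1).mpr (Real.summable_one_div_nat_pow.mpr one_lt_two)).mul_left _
  refine Summable.of_nonneg_of_le (fun k => by positivity) (fun k => ?_) hs
  have hk := hC (-(k + (n + 1 : ℕ) / 2))
  have heq : ∫ x in (-π)..π, f x * Complex.exp (Complex.I * ((k : ℂ) + ((n + 1 : ℕ) : ℂ) / 2) * x) =
      ∫ u : ℝ, (Set.Ioo (-π) π).indicator f u *
        Complex.exp (-(Complex.I * ((-(k + (n + 1 : ℕ) / 2) : ℝ) : ℂ) * u)) := by
    rw [intervalIntegral.integral_of_le (by linarith [Real.pi_pos]), integral_Ioc_eq_integral_Ioo,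
      ← integral_indicator measurableSet_Ioo]
    congr 1
    ext x
    rw [Set.indicator_mul_left]
    congr 2
    push_cast
    ring
  rw [← heq, abs_neg, abs_of_nonneg (by positivity)] at hk
  rw [mul_one_div, le_div_iff₀ (by positivity)]
  have hch : ((n + k).choose k : ℝ) ≤ ((2 : ℝ) * (k + (n + 1 : ℕ) / 2)) ^ n := by
    rw [Nat.choose_symm_add.symm]
    calc ((n + k).choose n : ℝ) ≤ ((n + k : ℕ) : ℝ) ^ n := by
          exact_mod_cast Nat.choose_le_pow (n + k) n
      _ ≤ _ := by
          gcongr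
          push_cast
          linarith [(k.cast_nonneg : (0 : ℝ) ≤ k)]
  have hsq : ((k + 1 : ℕ) : ℝ) ^ 2 ≤ ((2 : ℝ) * (k + (n + 1 : ℕ) / 2)) ^ 2 := by
    gcongr
    push_cast
    linarith [(k.cast_nonneg : (0 : ℝ) ≤ k), (n.cast_nonneg : (0 : ℝ) ≤ n)]
  calc _ ≤ ((2 : ℝ) * (k + (n + 1 : ℕ) / 2)) ^ n * ‖∫ x in (-π)..π, f x *
          Complex.exp (Complex.I * ((k : ℂ) + ((n + 1 : ℕ) : ℂ) / 2) * x)‖ *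
          ((2 : ℝ) * (k + (n + 1 : ℕ) / 2)) ^ 2 := by gcongr
    _ = 2 ^ (n + 2) * ((k + (n + 1 : ℕ) / 2) ^ (n + 2) * ‖∫ x in (-π)..π, f x *
          Complex.exp (Complex.I * ((k : ℂ) + ((n + 1 : ℕ) : ℂ) / 2) * x)‖) := by
        rw [mul_pow, mul_pow]
        ring
    _ ≤ _ := by gcongr

theorem star_integral_mul_cayley_factor (n k : ℕ) (F : ℝ → ℂ) :
    (starRingEnd ℂ) (∫ u : ℝ, F u * (((1 - Complex.I * u / 2) ^ (n + 1))⁻¹ * cayley u ^ k)) =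
      ∫ u : ℝ, (starRingEnd ℂ) (F u) *
        (((1 + Complex.I * u / 2) ^ (n + 1))⁻¹ * cayley (-u) ^ k) := by
  rw [← integral_conj]
  congr 1
  ext u
  simp [cayley, map_ofNat (starRingEnd ℂ) 2, neg_div, sub_neg_eq_add, ← sub_eq_add_neg]

theorem star_fourier_neg (F : ℝ → ℂ) (p : ℝ) :
    (starRingEnd ℂ) (∫ u : ℝ, F u * Complex.exp (-(Complex.I * (-p : ℝ) * u))) =
      ∫ u : ℝ, (starRingEnd ℂ) (F u) * Complex.exp (-(Complex.I * p * u)) := by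
  rw [← integral_conj]
  congr 1
  ext u
  simp [← Complex.exp_conj]

theorem stmt0 (m : ℕ) (hm : 1 ≤ m) (f g : ℝ → ℂ)
    (hf : ContDiff ℝ (⊤ : ℕ∞) f) (hg : ContDiff ℝ (⊤ : ℕ∞) g)
    (hfper : ∀ x : ℝ, f (x + 2 * π) = (-1 : ℂ) ^ m * f x)
    (hgper : ∀ x : ℝ, g (x + 2 * π) = (-1 : ℂ) ^ m * g x)
    (hvanish : ∃ δ : ℝ, 0 < δ ∧ ∀ x ∈ Set.Ioo (π - δ) (π + δ), f x = 0 ∧ g x = 0) :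
    let fhat : ℕ → ℂ := fun k =>
      (2 * (π : ℂ))⁻¹ * ∫ x in (-π)..π, f x * Complex.exp (Complex.I * ((k : ℂ) + (m : ℂ) / 2) * x)
    let ghat : ℕ → ℂ := fun k =>
      (2 * (π : ℂ))⁻¹ * ∫ x in (-π)..π, g x * Complex.exp (Complex.I * ((k : ℂ) + (m : ℂ) / 2) * x)
    let fR : ℝ → ℂ := fun x =>
      (((1 + x ^ 2 / 4 : ℝ) ^ ((m : ℝ) / 2 - 1) : ℝ) : ℂ) * f (2 * Real.arctan (x / 2))
    let gR : ℝ → ℂ := fun x =>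
      (((1 + x ^ 2 / 4 : ℝ) ^ ((m : ℝ) / 2 - 1) : ℝ) : ℂ) * g (2 * Real.arctan (x / 2))
    let fhatR : ℝ → ℂ := fun p =>
      ((Real.sqrt (2 * π) : ℝ) : ℂ)⁻¹ * ∫ x : ℝ, fR x * Complex.exp (-(Complex.I * p * x))
    let ghatR : ℝ → ℂ := fun p =>
      ((Real.sqrt (2 * π) : ℝ) : ℂ)⁻¹ * ∫ x : ℝ, gR x * Complex.exp (-(Complex.I * p * x))
    Summable (fun k : ℕ => ‖((m + k - 1).choose k : ℂ) * (starRingEnd ℂ) (fhat k) * ghat k‖) ∧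
    ∑' k : ℕ, ((m + k - 1).choose k : ℂ) * (starRingEnd ℂ) (fhat k) * ghat k =
      (2 * (π : ℂ) * ((m - 1).factorial : ℂ))⁻¹ *
        ∫ p in Set.Ioi (0 : ℝ),
          (starRingEnd ℂ) (fhatR (-p)) * ghatR (-p) * (p : ℂ) ^ (m - 1) := by
  intro fhat ghat fR gR fhatR ghatR
  obtain ⟨n, rfl⟩ : ∃ n, m = n + 1 := ⟨m - 1, by omega⟩
  obtain ⟨δ, hδ, hδ0⟩ := hvanish
  have hneg {h : ℝ → ℂ} (hper : ∀ x : ℝ, h (x + 2 * π) = (-1 : ℂ) ^ (n + 1) * h x)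
      (h0 : ∀ x ∈ Set.Ioo (π - δ) (π + δ), h x = 0) :
      ∀ x ∈ Set.Ioo (-π - δ) (-π + δ), h x = 0 := by
    intro x hx
    have := hper x
    rw [h0 (x + 2 * π) ⟨by linarith [hx.1], by linarith [hx.2]⟩] at this
    simpa using this.symm
  have hf₁ : ∀ x ∈ Set.Ioo (π - δ) (π + δ), f x = 0 := fun x hx => (hδ0 x hx).1
  have hg₁ : ∀ x ∈ Set.Ioo (π - δ) (π + δ), g x = 0 := fun x hx => (hδ0 x hx).2
  have hf₂ := hneg hfper hf₁
  have hg₂ := hneg hgper hg₁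
  have hfc : HasCompactSupport fR := hasCompactSupport_realPullback (n + 1) hδ hf₁ hf₂
  have hgc : HasCompactSupport gR := hasCompactSupport_realPullback (n + 1) hδ hg₁ hg₂
  have hfs : ContDiff ℝ (⊤ : ℕ∞) fR := contDiff_realPullback (n + 1) hf
  have hgs : ContDiff ℝ (⊤ : ℕ∞) gR := contDiff_realPullback (n + 1) hg
  let G : ℝ → ℂ := fun u => (starRingEnd ℂ) (fR u)
  have hGc : HasCompactSupport G := hfc.comp_left (map_zero _)
  have hGs : ContDiff ℝ (⊤ : ℕ∞) G := Complex.conjCLE.contDiff.comp hfs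
  have hfhat (k : ℕ) : fhat k = (2 * (π : ℂ))⁻¹ *
      ∫ u : ℝ, fR u * (((1 - Complex.I * u / 2) ^ (n + 1))⁻¹ * cayley u ^ k) :=
    congrArg (fun z => (2 * (π : ℂ))⁻¹ * z) (integral_circle_eq_integral_realPullback (n + 1) k f)
  have hghat (k : ℕ) : ghat k = (2 * (π : ℂ))⁻¹ *
      ∫ u : ℝ, gR u * (((1 - Complex.I * u / 2) ^ (n + 1))⁻¹ * cayley u ^ k) :=
    congrArg (fun z => (2 * (π : ℂ))⁻¹ * z) (integral_circle_eq_integral_realPullback (n + 1) k g)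
  have hs := summable_choose_mul_fourierCoeff n hf hδ hf₁ hf₂
  have hs' : Summable fun k : ℕ => ((n + k).choose k : ℝ) *
      ‖∫ u : ℝ, G u * (((1 + Complex.I * u / 2) ^ (n + 1))⁻¹ * cayley (-u) ^ k)‖ := by
    refine hs.congr fun k => ?_
    rw [integral_circle_eq_integral_realPullback, ← Complex.norm_conj,
      star_integral_mul_cayley_factor]
    rfl
  obtain ⟨hsum, hmain⟩ := tsum_cayley_coeff_eq_integral n
    (hGs.continuous.integrable_of_hasCompactSupport hGc)
    (hgs.continuous.integrable_of_hasCompactSupport hgc) hs'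
    (integrable_fourier_mul_pow hGs hGc n).integrableOn
  have hterm (k : ℕ) : ((n + 1 + k - 1).choose k : ℂ) * (starRingEnd ℂ) (fhat k) * ghat k =
      ((2 * (π : ℂ))⁻¹) ^ 2 * (((n + k).choose k : ℂ) *
      (∫ u : ℝ, G u * (((1 + Complex.I * u / 2) ^ (n + 1))⁻¹ * cayley (-u) ^ k)) *
      ∫ v : ℝ, gR v * (((1 - Complex.I * v / 2) ^ (n + 1))⁻¹ * cayley v ^ k)) := by
    rw [hfhat, hghat, map_mul, star_integral_mul_cayley_factor, show n + 1 + k - 1 = n + k by omega]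
    simp only [map_inv₀, map_mul, Complex.conj_ofReal, map_ofNat, G]
    ring
  have hInt (p : ℝ) : (starRingEnd ℂ) (fhatR (-p)) * ghatR (-p) * (p : ℂ) ^ (n + 1 - 1) =
      (2 * (π : ℂ))⁻¹ * ((∫ u : ℝ, G u * Complex.exp (-(Complex.I * p * u))) *
        (p : ℂ) ^ n * ∫ v : ℝ, gR v * Complex.exp (Complex.I * p * v)) := by
    have hsqrt : ((√(2 * π) : ℝ) : ℂ)⁻¹ * ((√(2 * π) : ℝ) : ℂ)⁻¹ = (2 * (π : ℂ))⁻¹ := by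
      rw [← mul_inv, ← Complex.ofReal_mul, Real.mul_self_sqrt (by positivity)]
      push_cast
      rfl
    simp only [fhatR, ghatR]
    rw [map_mul, star_fourier_neg, map_inv₀, Complex.conj_ofReal, ← hsqrt, Nat.add_sub_cancel]
    simp only [Complex.ofReal_neg, mul_neg, neg_mul, neg_neg, G]
    ring
  simp_rw [hterm, hInt]
  constructor
  · simp_rw [norm_mul (((2 * (π : ℂ))⁻¹) ^ 2)]
    exact hsum.mul_left _
  · rw [tsum_mul_left, integral_const_mul, ← hmain, Nat.add_sub_cancel]
    have : (n.factorial : ℂ) ≠ 0 := by exact_mod_cast n.factorial_ne_zero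
    field_simp
end

section
/- Fix an integer m ≥ 1. Let f, g : ℝ → ℂ be smooth compactly supported functions with supp f ⊆ (-∞, 0). For ζ ∈ ℂ set f̂(ζ) := (2π)^{-1/2} ∫_ℝ f(x) e^{-iζx} dx, and for p ∈ ℝ set ĝ(p) := (2π)^{-1/2} ∫_ℝ g(x) e^{-ipx} dx. Define F(z) := ∫_0^{∞} conj(ĝ(p)) · e^{-πmz} · f̂(e^{-2πz} p) · p^{m-1} dp. Then: (a) for every z ∈ S̄ the integrand is absolutely integrable on (0, ∞), so F is well defined on S̄; (b) F is continuous on S̄; (c) F is holomorphic on S; (d) F is the unique such extension of its restriction to ℝ: if G is continuous on S̄, holomorphic on S, and G(t) = F(t) for all t ∈ ℝ, then G = F on S̄. -/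
open MeasureTheory Real

/-- A dominated integral of functions holomorphic on an open set is holomorphic there. -/
theorem differentiableOn_integral_of_dominated {α : Type*} [MeasurableSpace α] {μ : Measure α}
    {U : Set ℂ} (hU : IsOpen U) {F : ℂ → α → ℂ} {bound : α → ℝ}
    (hF_meas : ∀ z ∈ U, AEStronglyMeasurable (F z) μ)
    (h_bound : ∀ z ∈ U, ∀ a, ‖F z a‖ ≤ bound a) (bound_integrable : Integrable bound μ)
    (h_diff : ∀ a, DifferentiableOn ℂ (fun z => F z a) U) :
    DifferentiableOn ℂ (fun z => ∫ a, F z a ∂μ) U := by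
  intro z₀ hz₀
  obtain ⟨r, hr, hrU⟩ := Metric.isOpen_iff.1 hU z₀ hz₀
  have hsub : ∀ z ∈ Metric.ball z₀ (r / 2), Metric.closedBall z (r / 4) ⊆ U := by
    intro z hz w hw
    apply hrU
    rw [Metric.mem_ball] at *
    rw [Metric.mem_closedBall] at hw
    linarith [dist_triangle w z z₀]
  have hderiv : ∀ a, ∀ z ∈ U, HasDerivAt (fun z => F z a) (deriv (fun z => F z a) z) z :=
    fun a z hz => ((h_diff a).differentiableAt (hU.mem_nhds hz)).hasDerivAt
  refine (hasDerivAt_integral_of_dominated_loc_of_deriv_le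
    (F' := fun z a => deriv (fun z => F z a) z) (bound := fun a => bound a / (r / 4))
    (Metric.ball_mem_nhds z₀ (half_pos hr)) ?_ ?_ ?_ ?_ ?_ ?_).2.differentiableAt.differentiableWithinAt
  · filter_upwards [hU.mem_nhds hz₀] with z hz using hF_meas z hz
  · exact bound_integrable.mono' (hF_meas _ hz₀) (.of_forall (h_bound _ hz₀))
  · let u : ℕ → ℂ := fun n => z₀ + ((r / 2 / ((n : ℝ) + 1) : ℝ) : ℂ)
    have hpos : ∀ n : ℕ, 0 < r / 2 / ((n : ℝ) + 1) := fun n => by positivity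
    have huU : ∀ n, u n ∈ U := by
      intro n
      apply hrU
      have h1 : r / 2 / ((n : ℝ) + 1) ≤ r / 2 :=
        div_le_self (by positivity) (by linarith [n.cast_nonneg (α := ℝ)])
      rw [Metric.mem_ball, dist_eq_norm, add_sub_cancel_left, Complex.norm_real, Real.norm_eq_abs,
        abs_of_pos (hpos n)]
      linarith
    have hu : Filter.Tendsto u Filter.atTop (nhdsWithin z₀ {z₀}ᶜ) := by
      refine tendsto_nhdsWithin_iff.2 ⟨?_, .of_forall fun n => ?_⟩
      · have h1 : Filter.Tendsto (fun n : ℕ => r / 2 / ((n : ℝ) + 1)) Filter.atTop (nhds 0) := by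
          have := tendsto_one_div_add_atTop_nhds_zero_nat (𝕜 := ℝ) |>.const_mul (r / 2)
          simpa [div_eq_mul_inv] using this
        have h2 := (Complex.continuous_ofReal.tendsto 0).comp h1
        simpa [u] using h2.const_add z₀
      · have : ((r / 2 / ((n : ℝ) + 1) : ℝ) : ℂ) ≠ 0 :=
          Complex.ofReal_ne_zero.2 (hpos n).ne'
        simpa only [u, Set.mem_compl_iff, Set.mem_singleton_iff, add_eq_left] using this
    refine aestronglyMeasurable_of_tendsto_ae Filter.atTop
      (f := fun n a => slope (fun z => F z a) z₀ (u n)) (fun n => ?_) (.of_forall fun a => ?_)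
    · simp only [slope_def_module]
      exact ((hF_meas _ (huU n)).sub (hF_meas _ hz₀)).const_smul (u n - z₀)⁻¹
    · exact ((hderiv a z₀ hz₀).tendsto_slope).comp hu
  · refine .of_forall fun a z hz => ?_
    refine Complex.norm_deriv_le_of_forall_mem_sphere_norm_le (by positivity) ?_ fun w hw =>
      h_bound w (hsub z hz (Metric.sphere_subset_closedBall hw)) a
    exact ((h_diff a).mono (hsub z hz)).diffContOnCl_ball subset_rfl
  · exact bound_integrable.div_const _
  · refine .of_forall fun a z hz => hderiv a z ?_
    exact hsub z hz (Metric.mem_closedBall_self (by positivity))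

/-- The Fourier–Laplace integral of a continuous compactly supported function is entire. -/
theorem differentiable_integral_mul_cexp {f : ℝ → ℂ} (hf : Continuous f)
    (hfc : HasCompactSupport f) :
    Differentiable ℂ fun ζ : ℂ => ∫ x : ℝ, f x * Complex.exp (-(Complex.I * ζ * x)) := by
  intro ζ
  have hζ : ζ ∈ Metric.ball (0 : ℂ) (‖ζ‖ + 1) := by simp
  refine (differentiableOn_integral_of_dominated (bound := fun x => ‖f x‖ * exp ((‖ζ‖ + 1) * |x|))
    Metric.isOpen_ball ?_ ?_ ?_ ?_).differentiableAt (Metric.isOpen_ball.mem_nhds hζ)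
  · intro z _
    exact Continuous.aestronglyMeasurable (by fun_prop)
  · intro z hz x
    rw [mem_ball_zero_iff] at hz
    rw [norm_mul]
    gcongr
    refine (Complex.norm_exp_le_exp_norm _).trans (exp_le_exp.2 ?_)
    rw [norm_neg, norm_mul, norm_mul, Complex.norm_I, one_mul, Complex.norm_real, norm_eq_abs]
    gcongr
  · exact Continuous.integrable_of_hasCompactSupport (by fun_prop) hfc.norm.mul_right
  · intro x
    fun_prop

/-- On the closed upper half-plane, the Fourier–Laplace integral of a function supported on the
negative half-line is bounded by the `L¹` norm. -/
theorem norm_integral_mul_cexp_le {f : ℝ → ℂ} (hf : Integrable f)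
    (hsupp : tsupport f ⊆ Set.Iio 0) {ζ : ℂ} (hζ : 0 ≤ ζ.im) :
    ‖∫ x : ℝ, f x * Complex.exp (-(Complex.I * ζ * x))‖ ≤ ∫ x : ℝ, ‖f x‖ := by
  refine norm_integral_le_of_norm_le hf.norm (.of_forall fun x => ?_)
  by_cases hx : f x = 0
  · simp [hx]
  have hx0 : x < 0 := hsupp (subset_tsupport f hx)
  rw [norm_mul, Complex.norm_exp]
  refine mul_le_of_le_one_right (norm_nonneg _) (exp_le_one_iff.2 ?_)
  simp
  exact mul_nonpos_of_nonneg_of_nonpos hζ hx0.le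

open FourierTransform in
/-- The Fourier integral of a test function decays faster than any power. -/
theorem integrable_integral_mul_cexp_mul_pow {g : ℝ → ℂ} (hg : ContDiff ℝ (⊤ : ℕ∞) g)
    (hgc : HasCompactSupport g) (k : ℕ) :
    Integrable fun p : ℝ =>
      ‖∫ x : ℝ, g x * Complex.exp (-(Complex.I * p * x))‖ * |p| ^ k := by
  have h := (SchwartzMap.integrable_pow_mul volume (𝓕 (hgc.toSchwartzMap hg)) k).comp_div
    (R := 2 * π) (by positivity)
  refine (h.const_mul ((2 * π) ^ k)).congr (.of_forall fun p => ?_)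
  have hp : 𝓕 (hgc.toSchwartzMap hg) (p / (2 * π)) =
      ∫ x : ℝ, g x * Complex.exp (-(Complex.I * p * x)) := by
    rw [SchwartzMap.fourier_coe, fourier_real_eq_integral_exp_smul]
    congr 1 with x
    have : (π : ℂ) ≠ 0 := Complex.ofReal_ne_zero.2 pi_ne_zero
    rw [smul_eq_mul, mul_comm]
    congr 2
    push_cast
    field_simp
  simp only [hp]
  rw [norm_div, norm_eq_abs, norm_eq_abs, abs_of_pos (by positivity : 0 < 2 * π), div_pow]
  have : (2 * π) ^ k ≠ 0 := by positivity
  field_simp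

/-- A function continuous up to the upper edge of a horizontal strip, holomorphic inside and
vanishing on the upper edge, vanishes at the centre of every square hanging from that edge. -/
theorem eq_zero_of_square {H : ℂ → ℂ} {c : ℂ} (hc : c.im < 0)
    (hcont : ContinuousOn H {z | 2 * c.im ≤ z.im ∧ z.im ≤ 0})
    (hdiff : DifferentiableOn ℂ H {z | 2 * c.im < z.im ∧ z.im < 0})
    (hzero : ∀ t : ℝ, H t = 0) : H c = 0 := by
  let r : ℝ := -c.im
  have hr : 0 < r := neg_pos.2 hc
  let U : Set ℂ := Set.Ioo (-r) r ×ℂ Set.Ioo (-r) r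
  have hcl : closure U = Set.Icc (-r) r ×ℂ Set.Icc (-r) r := by
    rw [Complex.closure_reProdIm, closure_Ioo (by linarith)]
  have hUo : IsOpen U := isOpen_Ioo.reProdIm isOpen_Ioo
  let P : ℂ → ℂ := fun w => H (c + w) * H (c + Complex.I * w) * H (c - w) * H (c - Complex.I * w)
  have hP : DiffContOnCl ℂ P U := by
    refine ⟨?_, ?_⟩
    · refine DifferentiableOn.mul (.mul (.mul ?_ ?_) ?_) ?_ <;>
      · refine hdiff.comp (by fun_prop) ?_
        intro w hw
        simp only [U, Complex.mem_reProdIm, Set.mem_Ioo, r] at hw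
        obtain ⟨⟨h1, h2⟩, h3, h4⟩ := hw
        constructor <;> simp <;> linarith
    · rw [hcl]
      refine ContinuousOn.mul (.mul (.mul ?_ ?_) ?_) ?_ <;>
      · refine hcont.comp (by fun_prop) ?_
        intro w hw
        simp only [Complex.mem_reProdIm, Set.mem_Icc, r] at hw
        obtain ⟨⟨h1, h2⟩, h3, h4⟩ := hw
        constructor <;> simp <;> linarith
  have hreal : ∀ z : ℂ, z.im = 0 → H z = 0 := fun z hz => by
    rw [← hzero z.re]
    congr 1
    exact Complex.ext rfl hz
  have hfr : ∀ w ∈ frontier U, ‖P w‖ ≤ 0 := by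
    intro w hw
    rw [Complex.frontier_reProdIm, frontier_Ioo (by linarith)] at hw
    rw [norm_le_zero_iff]
    rcases hw with ⟨-, hw | hw⟩ | ⟨hw | hw, -⟩
    · have : H (c - w) = 0 := hreal _ (by simp [show w.im = -r from hw, r])
      simp [P, this]
    · have : H (c + w) = 0 := hreal _ (by simp [show w.im = r from hw, r])
      simp [P, this]
    · have : H (c - Complex.I * w) = 0 := hreal _ (by simp [show w.re = -r from hw, r])
      simp [P, this]
    · have : H (c + Complex.I * w) = 0 := hreal _ (by simp [show w.re = r from hw, r])
      simp [P, this]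
  have hUb : Bornology.IsBounded U :=
    (Metric.isBounded_Ioo _ _).reProdIm (Metric.isBounded_Ioo _ _)
  have h0 := Complex.norm_le_of_forall_mem_frontier_norm_le hUb hP hfr (z := 0)
    (subset_closure (by simp [U, Complex.mem_reProdIm, hr]))
  simpa [P] using norm_le_zero_iff.1 h0

/-- A function continuous on a closed horizontal strip, holomorphic inside, and vanishing on the
upper edge vanishes identically. -/
theorem eq_zero_on_strip {b : ℝ} (hb : b < 0) {H : ℂ → ℂ}
    (hcont : ContinuousOn H {z | b ≤ z.im ∧ z.im ≤ 0})
    (hdiff : DifferentiableOn ℂ H {z | b < z.im ∧ z.im < 0})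
    (hzero : ∀ t : ℝ, H t = 0) : ∀ z : ℂ, b ≤ z.im ∧ z.im ≤ 0 → H z = 0 := by
  have hS : {z : ℂ | b < z.im ∧ z.im < 0} = Complex.im ⁻¹' Set.Ioo b 0 := rfl
  have hSo : IsOpen {z : ℂ | b < z.im ∧ z.im < 0} := isOpen_Ioo.preimage Complex.continuous_im
  have hconv : Convex ℝ {z : ℂ | b < z.im ∧ z.im < 0} :=
    (convex_Ioo b 0).linear_preimage Complex.imLm
  have hcl : {z : ℂ | b ≤ z.im ∧ z.im ≤ 0} ⊆ closure {z : ℂ | b < z.im ∧ z.im < 0} := by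
    rw [hS, Complex.closure_preimage_im, closure_Ioo hb.ne]
    exact subset_rfl
  have hupper : ∀ c : ℂ, b / 2 < c.im → c.im < 0 → H c = 0 := fun c h1 h2 =>
    eq_zero_of_square h2
      (hcont.mono fun z hz => ⟨by linarith [hz.1], hz.2⟩)
      (hdiff.mono fun z hz => ⟨by linarith [hz.1], hz.2⟩) hzero
  have hopen : Set.EqOn H 0 {z : ℂ | b < z.im ∧ z.im < 0} := by
    refine (hdiff.analyticOnNhd hSo).eqOn_zero_of_preconnected_of_eventuallyEq_zero
      hconv.isPreconnected (z₀ := ((b / 4 : ℝ) : ℂ) * Complex.I) ?_ ?_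
    · constructor <;> simp <;> linarith
    · have : IsOpen (Complex.im ⁻¹' Set.Ioo (b / 2) 0) :=
        isOpen_Ioo.preimage Complex.continuous_im
      filter_upwards [this.mem_nhds (x := ((b / 4 : ℝ) : ℂ) * Complex.I)
        (by constructor <;> simp <;> linarith)] with z hz using hupper z hz.1 hz.2
  exact fun z hz => hopen.of_subset_closure hcont continuousOn_const
    (fun z hz => ⟨hz.1.le, hz.2.le⟩) hcl hz

theorem stmt1 (m : ℕ) (hm : 1 ≤ m) (f g : ℝ → ℂ)
    (hf : ContDiff ℝ (⊤ : ℕ∞) f) (hg : ContDiff ℝ (⊤ : ℕ∞) g)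
    (hfc : HasCompactSupport f) (hgc : HasCompactSupport g)
    (hsupp : tsupport f ⊆ Set.Iio 0) :
    let fhat : ℂ → ℂ := fun ζ =>
      ((Real.sqrt (2 * π) : ℝ) : ℂ)⁻¹ * ∫ x : ℝ, f x * Complex.exp (-(Complex.I * ζ * x))
    let ghat : ℝ → ℂ := fun p =>
      ((Real.sqrt (2 * π) : ℝ) : ℂ)⁻¹ * ∫ x : ℝ, g x * Complex.exp (-(Complex.I * p * x))
    let F : ℂ → ℂ := fun z => ∫ p in Set.Ioi (0 : ℝ),
      (starRingEnd ℂ) (ghat p) * Complex.exp (-((π : ℂ) * m * z)) *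
        fhat (Complex.exp (-(2 * (π : ℂ) * z)) * p) * (p : ℂ) ^ (m - 1)
    let S : Set ℂ := {z : ℂ | -(1 / 2) < z.im ∧ z.im < 0}
    let Sbar : Set ℂ := {z : ℂ | -(1 / 2) ≤ z.im ∧ z.im ≤ 0}
    (∀ z ∈ Sbar, IntegrableOn (fun p : ℝ =>
        (starRingEnd ℂ) (ghat p) * Complex.exp (-((π : ℂ) * m * z)) *
          fhat (Complex.exp (-(2 * (π : ℂ) * z)) * p) * (p : ℂ) ^ (m - 1)) (Set.Ioi 0)) ∧
    ContinuousOn F Sbar ∧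
    DifferentiableOn ℂ F S ∧
    (∀ G : ℂ → ℂ, ContinuousOn G Sbar → DifferentiableOn ℂ G S →
      (∀ t : ℝ, G t = F t) → ∀ z ∈ Sbar, G z = F z) := by
  intro fhat ghat F S Sbar
  have hfhat : Differentiable ℂ fhat :=
    (differentiable_integral_mul_cexp hf.continuous hfc).const_mul _
  have hghat : Continuous ghat :=
    ((differentiable_integral_mul_cexp hg.continuous hgc).const_mul _).continuous.comp
      Complex.continuous_ofReal
  let C : ℝ := ‖((Real.sqrt (2 * π) : ℝ) : ℂ)⁻¹‖ * ∫ x : ℝ, ‖f x‖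
  have hC : ∀ ζ : ℂ, 0 ≤ ζ.im → ‖fhat ζ‖ ≤ C := fun ζ hζ => by
    rw [norm_mul]
    exact mul_le_mul_of_nonneg_left (norm_integral_mul_cexp_le
      (hf.continuous.integrable_of_hasCompactSupport hfc) hsupp hζ) (norm_nonneg _)
  -- the integrand without the factor `exp (-π m z)`, which is independent of `p`
  let K : ℂ → ℝ → ℂ := fun z p =>
    (starRingEnd ℂ) (ghat p) * fhat (Complex.exp (-(2 * (π : ℂ) * z)) * p) * (p : ℂ) ^ (m - 1)
  have hK : ∀ z p, (starRingEnd ℂ) (ghat p) * Complex.exp (-((π : ℂ) * m * z)) *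
      fhat (Complex.exp (-(2 * (π : ℂ) * z)) * p) * (p : ℂ) ^ (m - 1) =
      Complex.exp (-((π : ℂ) * m * z)) * K z p := fun z p => by ring
  let T : ℂ → ℝ → ℂ := fun z => (Set.Ioi (0 : ℝ)).indicator (K z)
  let B : ℝ → ℝ := fun p => C * (‖ghat p‖ * |p| ^ (m - 1))
  have hB : Integrable B := by
    have := (integrable_integral_mul_cexp_mul_pow hg hgc (m - 1)).const_mul
      ‖((Real.sqrt (2 * π) : ℝ) : ℂ)⁻¹‖
    refine (this.congr (.of_forall fun p => ?_)).const_mul C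
    simp only [ghat, norm_mul]
    ring
  have hKc : ∀ z, Continuous (K z) := fun z =>
    ((Complex.continuous_conj.comp hghat).mul (hfhat.continuous.comp (by fun_prop))).mul
      (by fun_prop)
  have hTm : ∀ z, AEStronglyMeasurable (T z) := fun z =>
    (hKc z).aestronglyMeasurable.indicator measurableSet_Ioi
  have hC0 : 0 ≤ C := (norm_nonneg _).trans (hC 0 le_rfl)
  have hTb : ∀ z ∈ Sbar, ∀ p, ‖T z p‖ ≤ B p := by
    intro z hz p
    by_cases hp : p ∈ Set.Ioi (0 : ℝ)
    · have him : 0 ≤ (Complex.exp (-(2 * (π : ℂ) * z)) * p).im := by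
        rw [Complex.im_mul_ofReal, Complex.exp_im]
        refine mul_nonneg (mul_nonneg (exp_pos _).le ?_) (le_of_lt hp)
        apply sin_nonneg_of_nonneg_of_le_pi <;> simp <;> nlinarith [pi_pos, hz.1, hz.2]
      simp only [T, Set.indicator_of_mem hp, K, B, norm_mul, RCLike.norm_conj, norm_pow,
        Complex.norm_real, norm_eq_abs]
      have := mul_le_mul_of_nonneg_right (hC _ him)
        (by positivity : 0 ≤ ‖ghat p‖ * |p| ^ (m - 1))
      linarith
    · simp only [T, Set.indicator_of_notMem hp, norm_zero, B]
      positivity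
  have hKd : ∀ p, Differentiable ℂ fun z => K z p := fun p =>
    ((hfhat.comp (by fun_prop)).const_mul _).mul_const _
  have hTd : ∀ p, Differentiable ℂ fun z => T z p := by
    intro p
    by_cases hp : p ∈ Set.Ioi (0 : ℝ)
    · simpa only [T, Set.indicator_of_mem hp] using hKd p
    · simpa only [T, Set.indicator_of_notMem hp] using differentiable_const 0
  have hF : F = fun z => Complex.exp (-((π : ℂ) * m * z)) * ∫ p, T z p := by
    funext z
    simp only [F, hK, T]
    rw [integral_const_mul, integral_indicator measurableSet_Ioi]
  have hSsub : S ⊆ Sbar := fun z hz => ⟨hz.1.le, hz.2.le⟩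
  have hSo : IsOpen S := isOpen_Ioo.preimage Complex.continuous_im
  have hFc : ContinuousOn F Sbar := by
    rw [hF]
    exact ContinuousOn.mul (by fun_prop) (continuousOn_of_dominated (fun z _ => hTm z)
      (fun z hz => .of_forall (hTb z hz)) hB
      (.of_forall fun p => (hTd p).continuous.continuousOn))
  have hFd : DifferentiableOn ℂ F S := by
    rw [hF]
    exact DifferentiableOn.mul (by fun_prop) (differentiableOn_integral_of_dominated hSo
      (fun z _ => hTm z) (fun z hz => hTb z (hSsub hz)) hB fun p => (hTd p).differentiableOn)
  refine ⟨fun z hz => ?_, hFc, hFd, fun G hGc hGd hGF z hz => ?_⟩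
  · simp only [hK]
    exact ((integrable_indicator_iff measurableSet_Ioi).1
      (hB.mono' (hTm z) (.of_forall (hTb z hz)))).const_mul _
  · exact sub_eq_zero.1 (eq_zero_on_strip (H := fun z => G z - F z) (by norm_num)
      (hGc.sub hFc) (hGd.sub hFd) (fun t => sub_eq_zero.2 (hGF t)) z hz)
end
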